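/- For every u < ũ there exist constants c_8(u), c_9(u) > 0 such that for all integers L ≥ 1, sup_{𝒫, x∈𝒫} ℙ[the nearest-neighbor connected component of x in 𝒱^u∩𝒫 is finite and intersects ∂_int B(x,L)] ≤ c_8·e^{−c_9·L^{κ̃}}, where κ̃ = κ̃(u) ∈ (0,1) is the exponent in the stretched exponential decay of the *-crossing probability of ℐ^u in half-planes for u < ũ. -/

import Mathlib

open MeasureTheory Filter Set
open scoped ENNReal NNReal Topology Classical

noncomputable section

/-- The weighted graph `G`: an infinite connected graph of bounded degree, with a weight
`ρG` which is uniformly bounded and uniformly positive on edges, `α`-Ahlfors regular. -/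
structure GraphSetup where
  V : Type
  infV : Infinite V
  adjG : V → V → Prop
  adjG_symm : ∀ {y y'}, adjG y y' → adjG y' y
  adjG_irrefl : ∀ y, ¬adjG y y
  /-- `dG` is the graph distance on `G`; this characterization also encodes connectedness. -/
  dG : V → V → ℕ
  dG_spec : ∀ (y y' : V) (n : ℕ), dG y y' ≤ n ↔
    ∃ p : ℕ → V, p 0 = y ∧ p n = y' ∧ ∀ i < n, p i = p (i + 1) ∨ adjG (p i) (p (i + 1))
  ballG_fin : ∀ (y : V) (R : ℝ), {y' | (dG y y' : ℝ) ≤ R}.Finite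
  degBound : ℕ
  deg_fin : ∀ y : V, {y' | adjG y y'}.Finite
  deg_le : ∀ y : V, Nat.card {y' // adjG y y'} ≤ degBound
  ρG : V → V → ℝ
  ρG_symm : ∀ y y', ρG y y' = ρG y' y
  ρG_nonneg : ∀ y y', 0 ≤ ρG y y'
  ρG_pos_iff : ∀ y y', 0 < ρG y y' ↔ adjG y y'
  ρG_lbd : ℝ
  ρG_ubd : ℝ
  ρG_lbd_pos : 0 < ρG_lbd
  ρG_bounds : ∀ y y', adjG y y' → ρG_lbd ≤ ρG y y' ∧ ρG y y' ≤ ρG_ubd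
  α : ℝ
  β : ℝ
  α_gt_one : 1 < α
  β_ge_two : 2 ≤ β
  β_le_α_add_one : β ≤ α + 1
  cA : ℝ
  cA' : ℝ
  cA_pos : 0 < cA
  /-- `α`-Ahlfors regularity of `(G, ρG)`, lower bound. -/
  ahlfors_lb : ∀ (y : V) (R : ℝ), 1 / 2 ≤ R →
    cA * R ^ α ≤ ∑ y' ∈ (ballG_fin y R).toFinset, ∑' y'', ρG y' y''
  /-- `α`-Ahlfors regularity of `(G, ρG)`, upper bound. -/
  ahlfors_ub : ∀ (y : V) (R : ℝ), 1 / 2 ≤ R →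
    (∑ y' ∈ (ballG_fin y R).toFinset, ∑' y'', ρG y' y'') ≤ cA' * R ^ α

namespace GraphSetup

/-- The product graph `E = G × ℤ`. -/
abbrev E (S : GraphSetup) : Type := S.V × ℤ

instance (S : GraphSetup) : MeasurableSpace S.V := ⊤

/-- The exponent `ν = α - β/2`. -/
def ν (S : GraphSetup) : ℝ := S.α - S.β / 2

/-- Adjacency on `E = G × ℤ`. -/
def adjE (S : GraphSetup) (x x' : S.E) : Prop :=
  (x.2 = x'.2 ∧ S.adjG x.1 x'.1) ∨ (x.1 = x'.1 ∧ (x.2 - x'.2).natAbs = 1)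

/-- The weight on `E`: `ρG` on horizontal edges, `1` on vertical edges. -/
def ρE (S : GraphSetup) (x x' : S.E) : ℝ :=
  if x.2 = x'.2 then S.ρG x.1 x'.1
  else if x.1 = x'.1 ∧ (x.2 - x'.2).natAbs = 1 then 1 else 0

/-- `ρ(x) = Σ_{x' ~ x} ρ_{x,x'}`. -/
def ρEpt (S : GraphSetup) (x : S.E) : ℝ := ∑' x', S.ρE x x'

/-- Transition probability of the walk on `E`. -/
def ptrans (S : GraphSetup) (x x' : S.E) : ℝ := S.ρE x x' / S.ρEpt x

/-- The metric `d((y,z),(y',z')) = max (d_G(y,y'), |z - z'|^{2/β})` on `E`. -/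
def dE (S : GraphSetup) (x x' : S.E) : ℝ :=
  max (S.dG x.1 x'.1 : ℝ) (|(x.2 : ℝ) - (x'.2 : ℝ)| ^ (2 / S.β))

/-- Closed `d`-ball in `E`. -/
def ball (S : GraphSetup) (x : S.E) (r : ℝ) : Set S.E := {x' | S.dE x x' ≤ r}

/-- Vertex boundary `∂U`. -/
def vBoundary (S : GraphSetup) (U : Set S.E) : Set S.E :=
  {x | x ∉ U ∧ ∃ x' ∈ U, S.adjE x x'}

/-- Closure `U ∪ ∂U`. -/
def cl (S : GraphSetup) (U : Set S.E) : Set S.E := U ∪ S.vBoundary U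

/-- Interior vertex boundary `∂_int U`. -/
def intBoundary (S : GraphSetup) (U : Set S.E) : Set S.E :=
  {x | x ∈ U ∧ ∃ x', x' ∉ U ∧ S.adjE x x'}

/-- A nearest-neighbour path of length `n` contained in `A`. -/
def IsPathIn (S : GraphSetup) (A : Set S.E) (p : ℕ → S.E) (n : ℕ) : Prop :=
  (∀ i ≤ n, p i ∈ A) ∧ ∀ i < n, S.adjE (p i) (p (i + 1))

/-- `B₁` is connected to `B₂` by a nearest-neighbour path contained in `A`. -/
def ConnectsIn (S : GraphSetup) (A B₁ B₂ : Set S.E) : Prop :=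
  ∃ (n : ℕ) (p : ℕ → S.E), S.IsPathIn A p n ∧ p 0 ∈ B₁ ∧ p n ∈ B₂

/-- The connected component of `x` inside `A`. -/
def component (S : GraphSetup) (A : Set S.E) (x : S.E) : Set S.E :=
  {x' | S.ConnectsIn A {x} {x'}}

/-- `A` is a connected subset of `E`. -/
def IsConnectedSet (S : GraphSetup) (A : Set S.E) : Prop :=
  ∀ x ∈ A, ∀ x' ∈ A, S.ConnectsIn A {x} {x'}

/-- `C` separates `A` and `B` in `U`: the graph distance between `A` and `B` exceeds `1`
and every nearest-neighbour path from `∂A` to `∂B` remaining in `U` meets `C`. -/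
def Separates (S : GraphSetup) (A B C U : Set S.E) : Prop :=
  (∀ a ∈ A, ∀ b ∈ B, a ≠ b ∧ ¬S.adjE a b) ∧
  ∀ (n : ℕ) (p : ℕ → S.E), (∀ i ≤ n, p i ∈ U) → (∀ i < n, S.adjE (p i) (p (i + 1))) →
    p 0 ∈ S.vBoundary A → p n ∈ S.vBoundary B → ∃ i ≤ n, p i ∈ C

/-- The separation event `S_{x,L}`. -/
def sepEvent (S : GraphSetup) (x : S.E) (L : ℕ) : Set (Set S.E) :=
  {C | ∃ A₁ A₂ : Set S.E,
    A₁ ⊆ S.cl (S.ball x (3 * L)) ∧ A₂ ⊆ S.cl (S.ball x (3 * L)) ∧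
    S.IsConnectedSet A₁ ∧ S.IsConnectedSet A₂ ∧
    (∃ a ∈ A₁, ∃ a' ∈ A₁, (L : ℝ) ≤ S.dE a a') ∧
    (∃ a ∈ A₂, ∃ a' ∈ A₂, (L : ℝ) ≤ S.dE a a') ∧
    S.Separates A₁ A₂ C (S.ball x (5 * L))}

/-- A half-plane of `E = G × ℤ`: the product of a semi-infinite geodesic in `G` with `ℤ`. -/
structure HalfPlane (S : GraphSetup) where
  ray : ℕ → S.V
  geodesic : ∀ n m : ℕ, S.dG (ray n) (ray m) = Nat.dist n m

/-- The set of points of a half-plane. -/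
def HalfPlane.carrier {S : GraphSetup} (P : S.HalfPlane) : Set S.E :=
  {x | ∃ n, x.1 = P.ray n}

/-- `B₁` is connected to `B₂` by a `*`-path contained in `A ∩ 𝒫`. -/
def StarConnectsIn (S : GraphSetup) (P : S.HalfPlane) (A B₁ B₂ : Set S.E) : Prop :=
  ∃ (n : ℕ) (p : ℕ → S.E),
    (∀ i ≤ n, p i ∈ A ∧ p i ∈ P.carrier) ∧
    (∀ i < n, p i ≠ p (i + 1) ∧ S.dG (p i).1 (p (i + 1)).1 ≤ 1 ∧
      ((p i).2 - (p (i + 1)).2).natAbs ≤ 1) ∧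
    p 0 ∈ B₁ ∧ p n ∈ B₂

/-- An increasing event on `{0,1}^E` (configurations identified with subsets of `E`). -/
def IncreasingEvent (S : GraphSetup) (A : Set (Set S.E)) : Prop :=
  ∀ C C' : Set S.E, C ⊆ C' → C ∈ A → C' ∈ A

/-- A decreasing event on `{0,1}^E`. -/
def DecreasingEvent (S : GraphSetup) (A : Set (Set S.E)) : Prop :=
  ∀ C C' : Set S.E, C' ⊆ C → C ∈ A → C' ∈ A

/-- The event `A` only depends on the coordinates in `B`. -/
def DependsOn (S : GraphSetup) (A : Set (Set S.E)) (B : Set S.E) : Prop :=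
  ∀ C C' : Set S.E, C ∩ B = C' ∩ B → (C ∈ A ↔ C' ∈ A)

/-- The family `(G_{x,L})` cascades with complexity at most `lam`, with constant `c`. -/
def CascadesLe (S : GraphSetup) (Gf : S.E → ℕ → Set (Set S.E)) (lam c : ℝ) : Prop :=
  (∀ (x : S.E) (L : ℕ), 1 ≤ L → S.DependsOn (Gf x L) (S.ball x (10 * L))) ∧
  ∀ (ℓ : ℕ) (x : S.E) (L : ℕ), 1 ≤ L → 0 < ℓ → 100 ∣ ℓ →
    ∃ Λ : Finset S.E, ↑Λ ⊆ S.ball x (9 * ℓ * L) ∧ (Λ.card : ℝ) ≤ c * (ℓ : ℝ) ^ lam ∧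
      Gf x (ℓ * L) ⊆
        ⋃ x' ∈ Λ, ⋃ x'' ∈ Λ,
          ⋃ (_ : ((ℓ * L : ℕ) : ℝ) / 100 ≤ S.dE x' x''), Gf x' L ∩ Gf x'' L

/-- The length scales `L_n = ℓ₀ⁿ L₀`. -/
def Lscale (ℓ₀ L₀ n : ℕ) : ℕ := ℓ₀ ^ n * L₀

/-- Membership in `Λ_n`: an embedding of the dyadic tree of depth `n` in `E`,
with nested balls and spread-out children. -/
def IsTreeEmbed (S : GraphSetup) (ℓ₀ L₀ n : ℕ) (T : ∀ k : ℕ, (Fin k → Bool) → S.E) : Prop :=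
  ∀ k < n, ∀ (m : Fin k → Bool) (b : Bool),
    S.ball (T (k + 1) (Fin.snoc m b)) (10 * Lscale ℓ₀ L₀ (n - (k + 1))) ⊆
        S.ball (T k m) (10 * Lscale ℓ₀ L₀ (n - k)) ∧
      ((Lscale ℓ₀ L₀ (n - k) : ℝ)) / 100 ≤
        S.dE (T (k + 1) (Fin.snoc m false)) (T (k + 1) (Fin.snoc m true))

/-- The factor `1 + c₁ √K (k+1)^{-3/2} ℓ₀^{-(ν-ν')/2}`. -/
def decFactor (c₁ K νv ν' : ℝ) (ℓ₀ : ℕ) (k : ℕ) : ℝ :=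
  1 + c₁ * Real.sqrt K * ((k : ℝ) + 1) ^ (-(3 : ℝ) / 2) * (ℓ₀ : ℝ) ^ (-(νv - ν') / 2)

/-- The increasing sequence of levels `u_n⁺`. -/
def uPlusSeq (c₁ K νv ν' : ℝ) (ℓ₀ : ℕ) (u₀ : ℝ) (n : ℕ) : ℝ :=
  (∏ k ∈ Finset.range n, decFactor c₁ K νv ν' ℓ₀ k) * u₀

/-- The decreasing sequence of levels `u_n⁻`. -/
def uMinusSeq (c₁ K νv ν' : ℝ) (ℓ₀ : ℕ) (u₀ : ℝ) (n : ℕ) : ℝ :=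
  (∏ k ∈ Finset.range n, (decFactor c₁ K νv ν' ℓ₀ k)⁻¹) * u₀

/-- The limit `u_∞⁺` of `u_n⁺`. -/
def uPlusInf (c₁ K νv ν' : ℝ) (ℓ₀ : ℕ) (u₀ : ℝ) : ℝ := ⨆ n, uPlusSeq c₁ K νv ν' ℓ₀ u₀ n

/-- The limit `u_∞⁻` of `u_n⁻`. -/
def uMinusInf (c₁ K νv ν' : ℝ) (ℓ₀ : ℕ) (u₀ : ℝ) : ℝ := ⨅ n, uMinusSeq c₁ K νv ν' ℓ₀ u₀ n

/-- The error term `ε(u) = 2 e^{-K u L₀^ν ℓ₀^{ν'}} / (1 - e^{-K u L₀^ν ℓ₀^{ν'}})`. -/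
def epsDecouple (K u : ℝ) (L₀ ℓ₀ : ℕ) (νv ν' : ℝ) : ℝ :=
  2 * Real.exp (-(K * u * (L₀ : ℝ) ^ νv * (ℓ₀ : ℝ) ^ ν')) /
    (1 - Real.exp (-(K * u * (L₀ : ℝ) ^ νv * (ℓ₀ : ℝ) ^ ν')))

/-- The canonical law of the random walk on `E`, as a family of measures on trajectories. -/
structure WalkLaw (S : GraphSetup) where
  P : S.E → Measure (ℕ → S.E)
  isProb : ∀ x, IsProbabilityMeasure (P x)
  cyl : ∀ (x : S.E) (n : ℕ) (q : ℕ → S.E), q 0 = x →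
    P x {w | ∀ i ≤ n, w i = q i} =
      ENNReal.ofReal (∏ i ∈ Finset.range n, S.ptrans (q i) (q (i + 1)))
  cyl0 : ∀ (x : S.E) (q : ℕ → S.E), q 0 ≠ x → P x {w | w 0 = q 0} = 0

instance {S : GraphSetup} (W : WalkLaw S) (x : S.E) : IsProbabilityMeasure (W.P x) :=
  W.isProb x

namespace WalkLaw

variable {S : GraphSetup}

/-- `P_x[H_K < ∞]`, the probability to ever enter `K`. -/
def hitProb (W : WalkLaw S) (x : S.E) (K : Set S.E) : ℝ≥0∞ := W.P x {w | ∃ n, w n ∈ K}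

/-- `P_x[H̃_K = ∞]`, the probability never to hit `K` at a positive time. -/
def escProb (W : WalkLaw S) (x : S.E) (K : Set S.E) : ℝ≥0∞ :=
  W.P x {w | ∀ n, 1 ≤ n → w n ∉ K}

/-- `P_x[H_K < ∞, X_{H_K} = x']`, the probability to enter `K` for the first time at `x'`. -/
def entersAt (W : WalkLaw S) (x : S.E) (K : Set S.E) (x' : S.E) : ℝ≥0∞ :=
  W.P x {w | ∃ n, w n = x' ∧ ∀ m < n, w m ∉ K}

/-- The equilibrium measure `e_K`. -/
def equilibrium (W : WalkLaw S) (K : Set S.E) (x : S.E) : ℝ :=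
  if x ∈ K then (W.escProb x K).toReal * S.ρEpt x else 0

/-- The capacity `cap(K) = Σ_{x ∈ K} P_x[H̃_K = ∞] ρ(x)`. -/
def capacity (W : WalkLaw S) (K : Set S.E) : ℝ :=
  ∑' x : K, (W.escProb x.1 K).toReal * S.ρEpt x.1

/-- The Green density `g(x,x') = Σ_{n ≥ 0} P_x[X_n = x'] / ρ(x')`. -/
def green (W : WalkLaw S) (x x' : S.E) : ℝ :=
  (∑' n : ℕ, (W.P x {w | w n = x'}).toReal) / S.ρEpt x'

/-- The standing assumption `c (d(x,x') ∨ 1)^{-ν} ≤ g(x,x') ≤ c' (d(x,x') ∨ 1)^{-ν}`. -/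
def GreenBounds (W : WalkLaw S) (cg cg' : ℝ) : Prop :=
  0 < cg ∧ cg ≤ cg' ∧ ∀ x x' : S.E,
    cg * (max (S.dE x x') 1) ^ (-S.ν) ≤ W.green x x' ∧
      W.green x x' ≤ cg' * (max (S.dE x x') 1) ^ (-S.ν)

end WalkLaw

/-- Random interlacements on `E`, encoded by their canonical probability space and the
family of interlacement sets `ℐ^u`, `u ≥ 0`, with
`ℙ[𝒱^u ⊇ K] = exp(-u cap(K))` for all finite `K`. -/
structure Interlacement (S : GraphSetup) (W : WalkLaw S) where
  Ω : Type
  mΩ : MeasurableSpace Ω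
  prob : @Measure Ω mΩ
  isProb : IsProbabilityMeasure prob
  I : ℝ → Ω → Set S.E
  I_mono : ∀ u u' : ℝ, u ≤ u' → ∀ ω, I u ω ⊆ I u' ω
  vacant_law : ∀ u : ℝ, 0 ≤ u → ∀ K : Set S.E, K.Finite →
    prob {ω | Disjoint K (I u ω)} = ENNReal.ofReal (Real.exp (-(u * W.capacity K)))

namespace Interlacement

variable {S : GraphSetup} {W : WalkLaw S}

/-- The vacant set `𝒱^u = E ∖ ℐ^u`. -/
def vacant (RI : Interlacement S W) (u : ℝ) (ω : RI.Ω) : Set S.E := (RI.I u ω)ᶜ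

/-- The event that `x` lies in an infinite connected component of `𝒱^u`. -/
def percolates (RI : Interlacement S W) (x : S.E) (u : ℝ) : Set RI.Ω :=
  {ω | (S.component (RI.vacant u ω) x).Infinite}

/-- The one-arm event: `B(x,L)` is connected to `∂_int B(x,2L)` in `𝒱^u`. -/
def oneArm (RI : Interlacement S W) (x : S.E) (L : ℝ) (u : ℝ) : Set RI.Ω :=
  {ω | S.ConnectsIn (RI.vacant u ω) (S.ball x L) (S.intBoundary (S.ball x (2 * L)))}

/-- `sup_{x ∈ E} ℙ[B(x,L) ↔ ∂_int B(x,2L) in 𝒱^u]`. -/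
def oneArmSup (RI : Interlacement S W) (u : ℝ) (L : ℕ) : ℝ≥0∞ :=
  ⨆ x : S.E, RI.prob (RI.oneArm x L u)

/-- The set defining `u_*`. -/
def uStarSet (RI : Interlacement S W) : Set ℝ :=
  {u | 0 ≤ u ∧ ∀ x : S.E, RI.prob (RI.percolates x u) = 0}

/-- The critical level `u_*`. -/
def uStar (RI : Interlacement S W) : ℝ := sInf RI.uStarSet

/-- The set defining `u_**`. -/
def uStarStarSet (RI : Interlacement S W) : Set ℝ :=
  {u | 0 ≤ u ∧ Filter.liminf (fun L : ℕ => RI.oneArmSup u L) Filter.atTop = 0}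

/-- The critical level `u_**`. -/
def uStarStar (RI : Interlacement S W) : ℝ := sInf RI.uStarStarSet

/-- The `*`-crossing event for `ℐ^u` inside a half-plane. -/
def starCross (RI : Interlacement S W) (P : S.HalfPlane) (x : S.E) (L : ℝ) (u : ℝ) :
    Set RI.Ω :=
  {ω | S.StarConnectsIn P (RI.I u ω) (S.ball x L) (S.intBoundary (S.ball x (2 * L)))}

/-- `sup_{𝒫, x ∈ 𝒫} ℙ[B(x,L) ↔* ∂_int B(x,2L) in ℐ^u ∩ 𝒫]`. -/
def starSup (RI : Interlacement S W) (u : ℝ) (L : ℕ) : ℝ≥0∞ :=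
  ⨆ P : S.HalfPlane, ⨆ x : P.carrier, RI.prob (RI.starCross P x.1 L u)

/-- The set defining `ũ`. -/
def uTildeSet (RI : Interlacement S W) : Set ℝ :=
  {u | 0 ≤ u ∧ 0 < Filter.liminf (fun L : ℕ => RI.starSup u L) Filter.atTop}

/-- The critical level `ũ`. -/
def uTilde (RI : Interlacement S W) : ℝ := sInf RI.uTildeSet

/-- For an event `A` on `{0,1}^E`, the event `A^u` that the indicator of `ℐ^u` lies in `A`. -/
def eventAt (RI : Interlacement S W) (A : Set (Set S.E)) (u : ℝ) : Set RI.Ω :=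
  {ω | RI.I u ω ∈ A}

end Interlacement

end GraphSetup

open GraphSetup

/-- A closed `ZMod 2`-valued form on the half-plane grid, supported on the edges joining `C` to
`T`, is the coboundary of a function vanishing far to the right. -/
theorem exists_cut_potential (C T : ℕ → ℤ → Prop) (M : ℕ)
    (hM : ∀ n z, C n z → n < M ∧ z < M) (hdisj : ∀ n z, C n z → ¬T n z)
    (hT : ∀ (n n' n'' : ℕ) (z z' z'' : ℤ), T n z → C n' z' → ¬C n'' z'' →
      ((z' = z'' ∧ (n' = n'' + 1 ∨ n'' = n' + 1)) ∨
        (n' = n'' ∧ (z' = z'' + 1 ∨ z'' = z' + 1))) →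
      n ≤ n'' + 1 → n'' ≤ n + 1 → z ≤ z'' + 1 → z'' ≤ z + 1 → T n'' z'') :
    ∃ f : ℕ → ℤ → ZMod 2,
      (∀ n z, f n z = f (n + 1) z +
        if (C n z ∧ T (n + 1) z) ∨ (T n z ∧ C (n + 1) z) then 1 else 0) ∧
      (∀ n z, f n (z + 1) = f n z +
        if (C n z ∧ T n (z + 1)) ∨ (T n z ∧ C n (z + 1)) then 1 else 0) ∧
      ∀ n z, M ≤ n → f n z = 0 := by
  have hC : ∀ n z, M ≤ n → ¬C n z := fun n z h hc => by
    have := (hM n z hc).1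
    omega
  set h : ℕ → ℤ → ZMod 2 := fun n z =>
    if (C n z ∧ T (n + 1) z) ∨ (T n z ∧ C (n + 1) z) then 1 else 0 with hh
  set v : ℕ → ℤ → ZMod 2 := fun n z =>
    if (C n z ∧ T n (z + 1)) ∨ (T n z ∧ C n (z + 1)) then 1 else 0 with hv
  have hclosed : ∀ n z, h n (z + 1) + v (n + 1) z = h n z + v n z := by
    intro n z
    by_cases hany : ∃ i j : ℕ, i ≤ 1 ∧ j ≤ 1 ∧ T (n + i) (z + j)
    · obtain ⟨i, j, hi, hj, ht⟩ := hany
      have hiff : ∀ i' i'' j' j'' : ℕ, i'' ≤ 1 → j'' ≤ 1 →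
          ((j' = j'' ∧ (i' = i'' + 1 ∨ i'' = i' + 1)) ∨
            (i' = i'' ∧ (j' = j'' + 1 ∨ j'' = j' + 1))) →
          (C (n + i') (z + j') ∧ T (n + i'') (z + j'') ↔
            C (n + i') (z + j') ∧ ¬C (n + i'') (z + j'')) := by
        intro i' i'' j' j'' hi' hj' hadj
        refine ⟨fun ⟨h1, h2⟩ => ⟨h1, fun h3 => hdisj _ _ h3 h2⟩, fun ⟨h1, h2⟩ => ⟨h1, ?_⟩⟩
        exact hT _ _ _ _ _ _ ht h1 h2 (by omega) (by omega) (by omega) (by omega) (by omega)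
      have e1 := hiff 0 1 0 0 (by omega) (by omega) (by omega)
      have e2 := hiff 1 0 0 0 (by omega) (by omega) (by omega)
      have e3 := hiff 0 1 1 1 (by omega) (by omega) (by omega)
      have e4 := hiff 1 0 1 1 (by omega) (by omega) (by omega)
      have e5 := hiff 0 0 0 1 (by omega) (by omega) (by omega)
      have e6 := hiff 0 0 1 0 (by omega) (by omega) (by omega)
      have e7 := hiff 1 1 0 1 (by omega) (by omega) (by omega)
      have e8 := hiff 1 1 1 0 (by omega) (by omega) (by omega)
      simp only [Nat.cast_zero, Nat.cast_one, add_zero] at e1 e2 e3 e4 e5 e6 e7 e8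
      simp only [hh, hv, and_comm (a := T _ _), e1, e2, e3, e4, e5, e6, e7, e8]
      by_cases c1 : C n z <;> by_cases c2 : C (n + 1) z <;> by_cases c3 : C n (z + 1) <;>
        by_cases c4 : C (n + 1) (z + 1) <;> simp only [c1, c2, c3, c4] <;> decide
    · have t1 : ¬T n z := fun h => hany ⟨0, 0, by omega, by omega, by simpa using h⟩
      have t2 : ¬T (n + 1) z := fun h => hany ⟨1, 0, by omega, by omega, by simpa using h⟩
      have t3 : ¬T n (z + 1) := fun h => hany ⟨0, 1, by omega, by omega, by simpa using h⟩
      have t4 : ¬T (n + 1) (z + 1) := fun h => hany ⟨1, 1, by omega, by omega, by simpa using h⟩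
      simp [hh, hv, t1, t2, t3, t4]
  refine ⟨fun n z => ∑ i ∈ Finset.Ico n M, h i z, ?_, ?_, ?_⟩
  · intro n z
    rcases lt_or_ge n M with hn | hn
    · dsimp only
      rw [Finset.sum_eq_sum_Ico_succ_bot hn, add_comm]
    · simp [Finset.Ico_eq_empty_of_le hn, Finset.Ico_eq_empty_of_le (hn.trans n.le_succ),
        hC n z hn, hC (n + 1) z (by omega)]
  · intro n z
    change _ = _ + v n z
    have hvan : ∀ n, M ≤ n → v n z = 0 := fun n hn => by
      simp [hv, hC n z hn, hC n (z + 1) hn]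
    obtain ⟨d, hd⟩ : ∃ d, M ≤ n + d := ⟨M, by omega⟩
    induction d generalizing n with
    | zero => simp [Finset.Ico_eq_empty_of_le (show M ≤ n by omega), hvan n (by omega)]
    | succ d ih =>
      rcases lt_or_ge n M with hn | hn
      · have ih' := ih (n + 1) (by omega)
        dsimp only at ih' ⊢
        rw [Finset.sum_eq_sum_Ico_succ_bot hn, Finset.sum_eq_sum_Ico_succ_bot hn, ih']
        linear_combination hclosed n z
      · simp [Finset.Ico_eq_empty_of_le hn, hvan n hn]
  · intro n z hn
    simp [Finset.Ico_eq_empty_of_le hn]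

theorem exists_last {p : ℕ → Prop} {M : ℕ} (h0 : p 0) (hM : ∀ j, p j → j < M) :
    ∃ k, p k ∧ ∀ j, k < j → ¬p j := by
  refine ⟨Nat.findGreatest p M, Nat.findGreatest_spec (Nat.zero_le M) h0, fun j hj hp => ?_⟩
  exact Nat.findGreatest_is_greatest hj (hM j hp).le hp

/-- If `C` is bounded, connected, and `T` is a union of `*`-components of its outer boundary
containing the last exit point to the right of some point of `C`, then `T` contains all last exit
points to the right of, or above, points of `C`. -/
theorem exit_points_mem (C T : ℕ → ℤ → Prop) (M : ℕ)
    (hM : ∀ n z, C n z → n < M ∧ z < M) (hdisj : ∀ n z, C n z → ¬T n z)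
    (hT : ∀ (n n' n'' : ℕ) (z z' z'' : ℤ), T n z → C n' z' → ¬C n'' z'' →
      ((z' = z'' ∧ (n' = n'' + 1 ∨ n'' = n' + 1)) ∨
        (n' = n'' ∧ (z' = z'' + 1 ∨ z'' = z' + 1))) →
      n ≤ n'' + 1 → n'' ≤ n + 1 → z ≤ z'' + 1 → z'' ≤ z + 1 → T n'' z'')
    {n₀ : ℕ} {z₀ : ℤ}
    (hconn : ∀ F : ℕ → ℤ → Prop,
      (∀ (n n' : ℕ) (z z' : ℤ), C n z → C n' z' → F n z →
        ((z = z' ∧ (n = n' + 1 ∨ n' = n + 1)) ∨ (n = n' ∧ (z = z' + 1 ∨ z' = z + 1))) →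
        F n' z') →
      ∀ (n n' : ℕ) (z z' : ℤ), C n z → C n' z' → F n z → F n' z')
    (hlast : ∀ j, n₀ < j → ¬C j z₀) (h₀ : C n₀ z₀) (ha : T (n₀ + 1) z₀) :
    ∀ n z, C n z → ((∀ j, n < j → ¬C j z) → T (n + 1) z) ∧
      ((∀ w, z < w → ¬C n w) → T n (z + 1)) := by
  obtain ⟨f, hfh, hfv, hf0⟩ := exists_cut_potential C T M hM hdisj hT
  have hright : ∀ n z, (∀ j, n ≤ j → ¬C j z) → f n z = 0 := by
    intro n z hn
    obtain ⟨d, hd⟩ : ∃ d, M ≤ n + d := ⟨M, by omega⟩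
    induction d generalizing n with
    | zero => exact hf0 _ _ (by omega)
    | succ d ih =>
      rw [hfh, if_neg (by simp [hn n le_rfl, hn (n + 1) (by omega)]), add_zero]
      exact ih (n + 1) (fun j hj => hn j (by omega)) (by omega)
  have hup : ∀ n z, (∀ w, z ≤ w → ¬C n w) → f n z = 0 := by
    intro n z hn
    have step : ∀ k : ℕ, f n (z + k) = f n z := by
      intro k
      induction k with
      | zero => simp
      | succ k ih =>
        rw [Nat.cast_succ, ← add_assoc, hfv, if_neg, add_zero, ih]
        simp [hn (z + k) (by omega), hn (z + k + 1) (by omega)]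
    rw [← step (M + z.natAbs)]
    refine hright _ _ fun j _ hj => ?_
    have := (hM _ _ hj).2
    omega
  have hone : ∀ n z, C n z → f n z = 1 := by
    refine fun n z hc => hconn (fun n z => f n z = 1) ?_ _ _ _ _ h₀ hc ?_
    · rintro n n' z z' hc hc' hF (⟨rfl, rfl | rfl⟩ | ⟨rfl, rfl | rfl⟩)
      · rw [hfh, hF, if_neg (by simp [hdisj _ _ hc, hdisj _ _ hc']), add_zero]
      · rwa [hfh, if_neg (by simp [hdisj _ _ hc, hdisj _ _ hc']), add_zero] at hF
      · rwa [hfv, if_neg (by simp [hdisj _ _ hc, hdisj _ _ hc']), add_zero] at hF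
      · rw [hfv, hF, if_neg (by simp [hdisj _ _ hc, hdisj _ _ hc']), add_zero]
    · rw [hfh, hright (n₀ + 1) z₀ (fun j hj => hlast j (by omega)), if_pos (Or.inl ⟨h₀, ha⟩),
        zero_add]
  refine fun n z hc => ⟨fun hl => ?_, fun hl => ?_⟩
  · have h1 := hfh n z
    rw [hone n z hc, hright (n + 1) z (fun j hj => hl j (by omega))] at h1
    by_contra hnt
    rw [if_neg (by simp [hnt, hdisj _ _ hc])] at h1
    exact absurd h1 (by decide)
  · have h1 := hfv n z
    rw [hone n z hc, hup n (z + 1) (fun j hj => hl j (by omega))] at h1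
    by_contra hnt
    rw [if_neg (by simp [hnt, hdisj _ _ hc])] at h1
    exact absurd h1 (by decide)

namespace GraphSetup

variable {S : GraphSetup}

theorem dG_self (y : S.V) : S.dG y y = 0 :=
  Nat.le_zero.1 ((S.dG_spec y y 0).2 ⟨fun _ => y, rfl, rfl, fun _ hi => by omega⟩)

theorem dG_le_one_iff {y y' : S.V} : S.dG y y' ≤ 1 ↔ y = y' ∨ S.adjG y y' := by
  rw [S.dG_spec]
  constructor
  · rintro ⟨p, rfl, rfl, h⟩
    exact h 0 one_pos
  · intro h
    refine ⟨fun i => if i = 0 then y else y', by simp, by simp, fun i hi => ?_⟩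
    obtain rfl : i = 0 := by omega
    simpa using h

theorem dG_triangle (x y z : S.V) : S.dG x z ≤ S.dG x y + S.dG y z := by
  obtain ⟨p, hp0, hpn, hp⟩ := (S.dG_spec x y _).1 le_rfl
  obtain ⟨q, hq0, hqn, hq⟩ := (S.dG_spec y z _).1 le_rfl
  refine (S.dG_spec x z _).2
    ⟨fun i => if i ≤ S.dG x y then p i else q (i - S.dG x y), by simp [hp0], ?_, ?_⟩
  · by_cases h : S.dG y z = 0
    · rw [h, hq0] at hqn
      subst hqn
      simp only [h, add_zero, le_refl, if_true, hpn]
    · have : ¬S.dG x y + S.dG y z ≤ S.dG x y := by omega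
      simp only [this, if_false, Nat.add_sub_cancel_left, hqn]
  · intro i hi
    rcases lt_trichotomy i (S.dG x y) with h | h | h
    · simpa [h.le, Nat.succ_le_of_lt h] using hp i h
    · have h1 : ¬i + 1 ≤ S.dG x y := by omega
      have h2 : i + 1 - S.dG x y = 0 + 1 := by omega
      simp only [h.le, h1, if_true, if_false, h2]
      rw [h, hpn, ← hq0]
      exact hq 0 (by omega)
    · have h1 : ¬i + 1 ≤ S.dG x y := by omega
      have h2 : ¬i ≤ S.dG x y := by omega
      have h3 : i + 1 - S.dG x y = i - S.dG x y + 1 := by omega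
      simp only [h1, h2, if_false, h3]
      exact hq _ (by omega)

theorem two_div_β_pos : 0 < 2 / S.β := div_pos two_pos (by linarith [S.β_ge_two])

theorem two_div_β_le_one : 2 / S.β ≤ 1 :=
  (div_le_one (by linarith [S.β_ge_two])).2 S.β_ge_two

theorem dE_self (x : S.E) : S.dE x x = 0 := by
  simp [dE, dG_self, Real.zero_rpow two_div_β_pos.ne']

namespace HalfPlane

variable (P : S.HalfPlane)

theorem ray_injective : Function.Injective P.ray := by
  intro n m h
  have := P.geodesic n m
  rw [h, dG_self] at this
  unfold Nat.dist at this
  omega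

theorem adjG_ray_iff {n m : ℕ} : S.adjG (P.ray n) (P.ray m) ↔ n = m + 1 ∨ m = n + 1 := by
  have hd := P.geodesic n m
  unfold Nat.dist at hd
  constructor
  · intro h
    have h1 := dG_le_one_iff.2 (Or.inr h)
    have h2 : n ≠ m := by
      rintro rfl
      exact S.adjG_irrefl _ h
    omega
  · intro h
    refine (dG_le_one_iff.1 (by omega)).resolve_left fun he => ?_
    have := P.ray_injective he
    omega

theorem adjE_ray_iff {n m : ℕ} {z w : ℤ} : S.adjE (P.ray n, z) (P.ray m, w) ↔
    (z = w ∧ (n = m + 1 ∨ m = n + 1)) ∨ (n = m ∧ (z = w + 1 ∨ w = z + 1)) := by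
  simp only [adjE, P.adjG_ray_iff, P.ray_injective.eq_iff]
  have : (z - w).natAbs = 1 ↔ (z = w + 1 ∨ w = z + 1) := by omega
  rw [this]

end HalfPlane

theorem StarConnectsIn.append {P : S.HalfPlane} {A B : Set S.E} {b b' : S.E}
    (h : S.StarConnectsIn P A B {b}) (hb : b' ∈ A) (hbP : b' ∈ P.carrier)
    (h1 : S.dG b.1 b'.1 ≤ 1) (h2 : (b.2 - b'.2).natAbs ≤ 1) :
    S.StarConnectsIn P A B {b'} := by
  by_cases hne : b = b'
  · rwa [← hne]
  obtain ⟨n, p, hA, hs, h0, hn⟩ := h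
  rw [Set.mem_singleton_iff] at hn
  refine ⟨n + 1, fun i => if i ≤ n then p i else b', fun i hi => ?_, fun i hi => ?_, ?_, ?_⟩
  · by_cases hin : i ≤ n
    · simpa [hin] using hA i hin
    · simpa [hin] using ⟨hb, hbP⟩
  · rcases (Nat.lt_succ_iff.1 hi).lt_or_eq with hin | rfl
    · simpa [hin.le, Nat.succ_le_of_lt hin] using hs i hin
    · simpa [hn] using ⟨hne, h1, h2⟩
  · simpa using h0
  · simp

/-- A `*`-path from `a` to a point outside `B(a,2r)` crosses from `B(a,r)` to
`∂_int B(a,2r)`. -/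
theorem StarConnectsIn.crossing {P : S.HalfPlane} {A : Set S.E} {a b : S.E}
    (h : S.StarConnectsIn P A {a} {b}) {r : ℝ} (hr : 0 ≤ r) (hab : 2 * r < S.dE a b) :
    S.StarConnectsIn P A (S.ball a r) (S.intBoundary (S.ball a (2 * r))) := by
  obtain ⟨n, p, hA, hs, h0, hn⟩ := h
  rw [Set.mem_singleton_iff] at h0 hn
  have hex : ∃ i, i ≤ n ∧ p i ∉ S.ball a (2 * r) := ⟨n, le_rfl, by simpa [hn, ball] using hab⟩
  obtain ⟨hin, hout⟩ := Nat.find_spec hex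
  have hmin := fun j => Nat.find_min (H := hex) (m := j)
  have ha : ∀ s, 0 ≤ s → p 0 ∈ S.ball a s := fun s hs' => by simpa [ball, h0, dE_self] using hs'
  have hpos : Nat.find hex ≠ 0 := fun h => by
    rw [h] at hout
    exact hout (ha _ (by positivity))
  obtain ⟨i, hi⟩ := Nat.exists_eq_succ_of_ne_zero hpos
  rw [hi] at hin hout
  have hball : p i ∈ S.ball a (2 * r) := by
    by_contra hb
    exact hmin i (by omega) ⟨by omega, hb⟩
  obtain ⟨-, hs1, hs2⟩ := hs i hin
  refine ⟨i, p, fun j hj => hA j (by omega), fun j hj => hs j (by omega), ha r hr, hball, ?_⟩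
  simp only [ball, dE, Set.mem_ofPred_eq, Nat.succ_eq_add_one, not_le, lt_max_iff] at hout
  simp only [ball, dE, Set.mem_ofPred_eq, max_le_iff] at hball
  rcases hout with hout | hout
  · refine ⟨((p (i + 1)).1, (p i).2), ?_, Or.inl ⟨rfl, ?_⟩⟩
    · simp [ball, dE, hout]
    · refine (dG_le_one_iff.1 hs1).resolve_left fun he => ?_
      rw [← he] at hout
      linarith [hball.1]
  · refine ⟨((p i).1, (p (i + 1)).2), ?_, Or.inr ⟨rfl, ?_⟩⟩
    · simp [ball, dE, hout]
    · have : (p i).2 ≠ (p (i + 1)).2 := fun he => by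
        rw [← he] at hout
        linarith [hball.2]
      change ((p i).2 - (p (i + 1)).2).natAbs = 1
      omega

theorem component_subset {A : Set S.E} {x : S.E} : S.component A x ⊆ A := by
  rintro y ⟨n, p, hp, -, hn⟩
  rw [← Set.mem_singleton_iff.1 hn]
  exact hp.1 n le_rfl

theorem mem_component_of_adjE {A : Set S.E} {x y y' : S.E} (hy : y ∈ S.component A x)
    (hA : y' ∈ A) (h : S.adjE y y') : y' ∈ S.component A x := by
  obtain ⟨n, p, hp, h0, hn⟩ := hy
  rw [Set.mem_singleton_iff] at hn
  refine ⟨n + 1, fun i => if i ≤ n then p i else y', ⟨fun i hi => ?_, fun i hi => ?_⟩, ?_, ?_⟩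
  · by_cases hin : i ≤ n
    · simpa [hin] using hp.1 i hin
    · simpa [hin] using hA
  · rcases (Nat.lt_succ_iff.1 hi).lt_or_eq with hin | rfl
    · simpa [hin.le, Nat.succ_le_of_lt hin] using hp.2 i hin
    · simpa [hn] using h
  · simpa using h0
  · simp

theorem component_induction {A : Set S.E} {x : S.E} {F : S.E → Prop} (h0 : F x)
    (hs : ∀ y y', y ∈ S.component A x → y' ∈ S.component A x → F y → S.adjE y y' → F y') :
    ∀ y ∈ S.component A x, F y := by
  rintro y ⟨n, p, hp, hp0, hn⟩
  have hmem : ∀ i ≤ n, p i ∈ S.component A x := fun i hi =>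
    ⟨i, p, ⟨fun j hj => hp.1 j (hj.trans hi), fun j hj => hp.2 j (hj.trans_le hi)⟩, hp0, rfl⟩
  have : ∀ i ≤ n, F (p i) := by
    intro i
    induction i with
    | zero => exact fun _ => (Set.mem_singleton_iff.1 hp0) ▸ h0
    | succ i ih =>
      exact fun hi => hs _ _ (hmem i (by omega)) (hmem _ hi) (ih (by omega)) (hp.2 i hi)
  exact (Set.mem_singleton_iff.1 hn) ▸ this n le_rfl

/-- Points of `∂_int B(x,L)` are at distance at least `L` from `x` in `G`-projection, or nearly
at distance `L` in `ℤ`-projection. -/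
theorem dist_of_mem_intBoundary {x y : S.E} {L : ℕ} (h : y ∈ S.intBoundary (S.ball x L)) :
    L ≤ S.dG x.1 y.1 ∨ (L : ℝ) - 1 ≤ |(x.2 : ℝ) - y.2| ^ (2 / S.β) := by
  obtain ⟨-, w, hw, hadj⟩ := h
  simp only [ball, dE, Set.mem_ofPred_eq, not_le, lt_max_iff, Nat.cast_lt] at hw
  rcases hw with hw | hw
  · left
    have h1 : S.dG y.1 w.1 ≤ 1 := dG_le_one_iff.2 (by
      rcases hadj with ⟨-, h⟩ | ⟨h, -⟩
      exacts [Or.inr h, Or.inl h])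
    have := dG_triangle x.1 y.1 w.1
    omega
  · right
    have h1 : |(y.2 : ℝ) - w.2| ≤ 1 := by
      have : (y.2 - w.2).natAbs ≤ 1 := by
        rcases hadj with ⟨h, -⟩ | ⟨-, h⟩ <;> omega
      have h3 : |y.2 - w.2| ≤ 1 := abs_le.2 ⟨by omega, by omega⟩
      exact_mod_cast h3
    have h2 : |(x.2 : ℝ) - w.2| ≤ |(x.2 : ℝ) - y.2| + 1 :=
      (abs_sub_le _ (y.2 : ℝ) _).trans (by linarith)
    have h3 := Real.rpow_le_rpow (abs_nonneg _) h2 (two_div_β_pos (S := S)).le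
    have h4 := Real.rpow_add_le_add_rpow (abs_nonneg ((x.2 : ℝ) - y.2)) zero_le_one
      (two_div_β_pos (S := S)).le (two_div_β_le_one (S := S))
    rw [Real.one_rpow] at h4
    linarith

/-- Planar duality in a half-plane: around a large finite component of `Iᶜ ∩ 𝒫` there is a large
`*`-path of `I ∩ 𝒫` starting on the horizontal ray to the right of `x`. -/
theorem exists_starConnectsIn (P : S.HalfPlane) (I : Set S.E) (n₀ : ℕ) (z₀ : ℤ) (L : ℕ)
    (hfin : (S.component (Iᶜ ∩ P.carrier) (P.ray n₀, z₀)).Finite)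
    (hne : (S.component (Iᶜ ∩ P.carrier) (P.ray n₀, z₀) ∩
      S.intBoundary (S.ball (P.ray n₀, z₀) L)).Nonempty) :
    ∃ k b, S.StarConnectsIn P I {(P.ray (n₀ + k + 1), z₀)} {b} ∧
      ((k : ℝ) + 1 + L) / 4 ≤ S.dE (P.ray (n₀ + k + 1), z₀) b := by
  set D := S.component (Iᶜ ∩ P.carrier) (P.ray n₀, z₀) with hD
  obtain ⟨y, hyD, hyL⟩ := hne
  have hcar : ∀ n z, (P.ray n, z) ∈ P.carrier := fun n z => ⟨n, rfl⟩
  have h₀ : (P.ray n₀, z₀) ∈ D := by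
    obtain ⟨n, p, hp, hp0, -⟩ := hyD
    refine ⟨0, p, ⟨fun i hi => hp.1 i (by omega), fun i hi => by omega⟩, hp0, ?_⟩
    exact hp0
  set C : ℕ → ℤ → Prop := fun n z => (P.ray n, z) ∈ D with hC
  obtain ⟨M, hM⟩ : ∃ M : ℕ, ∀ n z, C n z → n < M ∧ z < M := by
    have hinj : Function.Injective fun q : ℕ × ℤ => ((P.ray q.1, q.2) : S.E) := by
      rintro ⟨n, z⟩ ⟨m, w⟩ h
      obtain ⟨h1, h2⟩ := Prod.ext_iff.1 h
      exact Prod.ext (P.ray_injective h1) h2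
    have hf := hfin.preimage (f := fun q : ℕ × ℤ => ((P.ray q.1, q.2) : S.E)) hinj.injOn
    obtain ⟨M, hM⟩ := (hf.image fun q : ℕ × ℤ => q.1 + q.2.natAbs).bddAbove
    refine ⟨M + 1, fun n z hc => ?_⟩
    have : n + z.natAbs ≤ M := hM ⟨(n, z), hc, rfl⟩
    omega
  have hlast : ∀ n z, C n z → ∃ k, C (n + k) z ∧ ∀ j, n + k < j → ¬C j z := by
    intro n z hc
    obtain ⟨k, hk, hl⟩ := exists_last (p := fun k => C (n + k) z) (M := M) hc
      fun j hj => by have := (hM _ _ hj).1; omega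
    refine ⟨k, hk, fun j hj hcj => hl (j - n) (by omega) ?_⟩
    rwa [show n + (j - n) = j by omega]
  have hlastup : ∀ n z, C n z → ∃ w, C n w ∧ ∀ j, w < j → ¬C n j := by
    intro n z hc
    obtain ⟨k, hk, hl⟩ := exists_last (p := fun k => C n (z + k)) (M := M + z.natAbs)
      (by simpa using hc) fun j hj => by have := (hM _ _ hj).2; omega
    refine ⟨z + k, hk, fun j hj hcj => hl (j - z).toNat (by omega) ?_⟩
    rwa [show z + ((j - z).toNat : ℤ) = j by omega]
  have hbd : ∀ n' z' n'' z'', C n' z' → ¬C n'' z'' →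
      S.adjE (P.ray n', z') (P.ray n'', z'') → (P.ray n'', z'') ∈ I := by
    intro n' z' n'' z'' hc hnc hadj
    by_contra hI
    exact hnc (mem_component_of_adjE hc ⟨hI, hcar _ _⟩ hadj)
  obtain ⟨k, hk, hkl⟩ := hlast n₀ z₀ h₀
  set a : S.E := (P.ray (n₀ + k + 1), z₀) with ha
  have haI : a ∈ I := hbd _ _ _ _ hk (hkl _ (by omega)) (P.adjE_ray_iff.2 (by simp))
  have hexit := exit_points_mem C (fun n z => S.StarConnectsIn P I {a} {(P.ray n, z)}) M hM
    (by
      rintro n z hc ⟨m, p, hp, -, -, hm⟩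
      have h1 := (hp m le_rfl).1
      rw [Set.mem_singleton_iff.1 hm] at h1
      exact (component_subset hc).1 h1)
    (by
      intro n n' n'' z z' z'' ht hc hnc hadj h1 h2 h3 h4
      refine ht.append (hbd _ _ _ _ hc hnc (P.adjE_ray_iff.2 hadj)) (hcar _ _) ?_ ?_
      · change S.dG (P.ray n) (P.ray n'') ≤ 1
        rw [P.geodesic]
        unfold Nat.dist
        omega
      · change (z - z'').natAbs ≤ 1
        omega)
    (n₀ := n₀ + k) (z₀ := z₀)
    (by
      intro F hstep
      have hall : ∀ n z, C n z → (F n z ↔ F n₀ z₀) := by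
        intro n z hc
        refine component_induction
          (F := fun q => ∀ n z, q = (P.ray n, z) → (F n z ↔ F n₀ z₀)) ?_ ?_ _ hc n z rfl
        · intro n z h
          obtain ⟨h1, rfl⟩ := Prod.ext_iff.1 h
          rw [P.ray_injective h1]
        · rintro ⟨y, w⟩ q hy hq ih hadj n' z' rfl
          obtain ⟨n, rfl⟩ : ∃ n, y = P.ray n := (component_subset hy).2
          rw [P.adjE_ray_iff] at hadj
          rw [← ih n w rfl]
          exact ⟨fun h => hstep _ _ _ _ hq hy h (by omega),
            fun h => hstep _ _ _ _ hy hq h (by omega)⟩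
      intro n n' z z' hc hc' hF
      exact (hall n' z' hc').2 ((hall n z hc).1 hF))
    hkl hk ⟨0, fun _ => a, fun _ _ => ⟨haI, hcar _ _⟩, fun _ hi => by omega, rfl, rfl⟩
  obtain ⟨w₀, hw₀, hwl₀⟩ := hlastup n₀ z₀ h₀
  have hb₁ := (hexit n₀ w₀ hw₀).2 hwl₀
  have hd : ∀ n z, S.dE a (P.ray n, z) =
      max ((Nat.dist (n₀ + k + 1) n : ℕ) : ℝ) (|(z₀ : ℝ) - z| ^ (2 / S.β)) := fun n z => by
    simp only [dE, ha, P.geodesic]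
  have hd₁ : (k : ℝ) + 1 ≤ S.dE a (P.ray n₀, w₀ + 1) := by
    rw [hd]
    refine le_max_of_le_left ?_
    have : k + 1 ≤ Nat.dist (n₀ + k + 1) n₀ := by unfold Nat.dist; omega
    exact_mod_cast this
  obtain ⟨b₂, hb₂, hd₂⟩ : ∃ b, S.StarConnectsIn P I {a} {b} ∧
      (((L : ℝ) - 1) / 2 ≤ S.dE a b ∨ (L : ℝ) / 2 ≤ k + 1) := by
    obtain ⟨m, hm⟩ := (component_subset hyD).2
    obtain ⟨y₁, y₂⟩ := y
    obtain rfl : y₁ = P.ray m := hm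
    have hyC : C m y₂ := hyD
    have hdist := dist_of_mem_intBoundary hyL
    dsimp only at hdist
    rw [P.geodesic] at hdist
    obtain ⟨j, hj, hjl⟩ := hlast m y₂ hyC
    obtain ⟨w, hw, hwl⟩ := hlastup m y₂ hyC
    rcases hdist with hdist | hdist
    · unfold Nat.dist at hdist
      rcases le_total m n₀ with hmn | hmn
      · refine ⟨_, (hexit m w hw).2 hwl, Or.inl ?_⟩
        rw [hd]
        refine le_max_of_le_left ?_
        have : L ≤ Nat.dist (n₀ + k + 1) m := by unfold Nat.dist; omega
        have : (L : ℝ) ≤ _ := Nat.cast_le.2 this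
        linarith [Nat.cast_nonneg (α := ℝ) L]
      · refine ⟨_, (hexit (m + j) y₂ hj).1 hjl, ?_⟩
        by_cases hkL : (L : ℝ) / 2 ≤ k + 1
        · exact Or.inr hkL
        · left
          rw [hd]
          refine le_max_of_le_left ?_
          have h1 : L ≤ Nat.dist (n₀ + k + 1) (m + j + 1) + (k + 1) := by unfold Nat.dist; omega
          have h2 : (L : ℝ) ≤ (Nat.dist (n₀ + k + 1) (m + j + 1) : ℕ) + (k + 1) := by
            exact_mod_cast h1
          linarith
    · refine ⟨_, (hexit (m + j) y₂ hj).1 hjl, Or.inl ?_⟩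
      rw [hd]
      refine le_max_of_le_right ?_
      have h1 : 0 ≤ |(z₀ : ℝ) - y₂| ^ (2 / S.β) := by positivity
      linarith
  by_cases hcase : (L : ℝ) ≤ 3 * (k + 1)
  · exact ⟨k, _, hb₁, by linarith⟩
  · have : (0 : ℝ) ≤ k := k.cast_nonneg
    exact ⟨k, b₂, hb₂, by rcases hd₂ with h | h <;> linarith⟩

end GraphSetup

theorem summable_exp_neg_mul_rpow {c κ : ℝ} (hc : 0 < c) (hκ : 0 < κ) :
    Summable fun k : ℕ => Real.exp (-c * (k : ℝ) ^ κ) := by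
  refine summable_of_isBigO_nat (Real.summable_nat_rpow.mpr (show (-2 : ℝ) < -1 by norm_num)) ?_
  have h := ((isLittleO_exp_neg_mul_rpow_atTop hc (-2 / κ)).comp_tendsto
    ((tendsto_rpow_atTop hκ).comp tendsto_natCast_atTop_atTop)).isBigO
  refine h.congr_right fun k => ?_
  change ((k : ℝ) ^ κ) ^ (-2 / κ) = _
  rw [← Real.rpow_mul k.cast_nonneg, mul_div_cancel₀ _ hκ.ne']

/-- Summing a stretched exponential bound over scales comparable to `L + k`, `k ≥ 0`. -/
theorem exists_tsum_stretched_exp_le {c₆ c₇ κ : ℝ} (hc₆ : 0 < c₆) (hc₇ : 0 < c₇) (hκ : 0 < κ) :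
    ∃ B c : ℝ, 0 ≤ B ∧ 0 < c ∧ ∀ L : ℕ, 16 ≤ L →
      ∑' k : ℕ, ENNReal.ofReal
          (c₆ * Real.exp (-c₇ * (((L + (k + 1)) / 16 : ℕ) : ℝ) ^ κ)) ≤
        ENNReal.ofReal (B * Real.exp (-c * (L : ℝ) ^ κ)) := by
  set q : ℝ := (1 / 32) ^ κ / 2 with hq
  have hqpos : 0 < q := by positivity
  have hsum := summable_exp_neg_mul_rpow (mul_pos hc₇ hqpos) hκ
  refine ⟨c₆ * ∑' k : ℕ, Real.exp (-(c₇ * q) * (k : ℝ) ^ κ), c₇ * q,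
    mul_nonneg hc₆.le (tsum_nonneg fun _ => (Real.exp_pos _).le), mul_pos hc₇ hqpos,
    fun L hL => ?_⟩
  have hterm : ∀ k : ℕ, c₆ * Real.exp (-c₇ * (((L + (k + 1)) / 16 : ℕ) : ℝ) ^ κ) ≤
      c₆ * Real.exp (-(c₇ * q) * (L : ℝ) ^ κ) * Real.exp (-(c₇ * q) * (k : ℝ) ^ κ) := by
    intro k
    rw [mul_assoc, ← Real.exp_add]
    have h1 : L + k ≤ 32 * ((L + (k + 1)) / 16) := by omega
    have h2 : 1 / 32 * ((L : ℝ) + k) ≤ ((L + (k + 1)) / 16 : ℕ) := by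
      have : ((L : ℝ) + k) ≤ 32 * ((L + (k + 1)) / 16 : ℕ) := by exact_mod_cast h1
      linarith
    have hL0 : (0 : ℝ) ≤ L := L.cast_nonneg
    have hk0 : (0 : ℝ) ≤ k := k.cast_nonneg
    have h3 := Real.rpow_le_rpow (by positivity) h2 hκ.le
    rw [Real.mul_rpow (by norm_num) (by positivity)] at h3
    have h4 : (L : ℝ) ^ κ ≤ (L + k : ℝ) ^ κ := Real.rpow_le_rpow hL0 (by linarith) hκ.le
    have h5 : (k : ℝ) ^ κ ≤ (L + k : ℝ) ^ κ := Real.rpow_le_rpow hk0 (by linarith) hκ.le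
    have h6 : q * (L : ℝ) ^ κ + q * (k : ℝ) ^ κ ≤ (((L + (k + 1)) / 16 : ℕ) : ℝ) ^ κ := by
      have h7 := mul_le_mul_of_nonneg_left (add_le_add h4 h5) hqpos.le
      have h8 : q * ((L + k : ℝ) ^ κ + (L + k : ℝ) ^ κ) = (1 / 32) ^ κ * (L + k : ℝ) ^ κ := by
        rw [hq]
        ring
      linarith
    have h9 := mul_le_mul_of_nonneg_left h6 hc₇.le
    gcongr
    linarith
  have hs := hsum.mul_left (c₆ * Real.exp (-(c₇ * q) * (L : ℝ) ^ κ))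
  calc _ ≤ ∑' k : ℕ, ENNReal.ofReal
        (c₆ * Real.exp (-(c₇ * q) * (L : ℝ) ^ κ) * Real.exp (-(c₇ * q) * (k : ℝ) ^ κ)) :=
        ENNReal.tsum_le_tsum fun k => ENNReal.ofReal_le_ofReal (hterm k)
    _ = _ := by
        rw [← ENNReal.ofReal_tsum_of_nonneg (fun k => by positivity) hs, tsum_mul_left]
        congr 1
        ring

/-- Union bound over the first exit point to the right of a large finite vacant component. -/
theorem GraphSetup.Interlacement.prob_finite_component_le {S : GraphSetup} {W : WalkLaw S}
    (RI : Interlacement S W) (u : ℝ) (P : S.HalfPlane) (x : P.carrier) (L : ℕ) :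
    RI.prob {ω | (S.component (RI.vacant u ω ∩ P.carrier) x.1).Finite ∧
        (S.component (RI.vacant u ω ∩ P.carrier) x.1 ∩
          S.intBoundary (S.ball x.1 L)).Nonempty} ≤
      ∑' k : ℕ, RI.starSup u ((L + (k + 1)) / 16) := by
  obtain ⟨⟨y, z₀⟩, n₀, hn₀⟩ := x
  obtain rfl : y = P.ray n₀ := hn₀
  let a : ℕ → P.carrier := fun k => ⟨(P.ray (n₀ + k + 1), z₀), _, rfl⟩
  calc _ ≤ RI.prob (⋃ k : ℕ, RI.starCross P (a k).1 ((L + (k + 1)) / 16 : ℕ) u) := by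
        refine measure_mono ?_
        rintro ω ⟨hfin, hne⟩
        obtain ⟨k, b, hb, hd⟩ := exists_starConnectsIn P (RI.I u ω) n₀ z₀ L hfin hne
        refine Set.mem_iUnion.2 ⟨k, hb.crossing (Nat.cast_nonneg _) (lt_of_lt_of_le ?_ hd)⟩
        have h1 : 8 * (2 * ((L + (k + 1)) / 16)) ≤ L + (k + 1) := by omega
        have h2 : (8 : ℝ) * (2 * ((L + (k + 1)) / 16 : ℕ)) ≤ L + (k + 1) := by exact_mod_cast h1
        have h3 : (0 : ℝ) ≤ k := k.cast_nonneg
        have h4 : (0 : ℝ) ≤ L := L.cast_nonneg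
        linarith
    _ ≤ ∑' k : ℕ, RI.prob (RI.starCross P (a k).1 ((L + (k + 1)) / 16 : ℕ) u) :=
        measure_iUnion_le _
    _ ≤ _ := ENNReal.tsum_le_tsum fun k => le_iSup₂_of_le P (a k) le_rfl

/-- Corollary 5.5: for `u < ũ`, with `κ̃ = κ̃(u)` the exponent of the stretched exponential
decay of the `*`-crossing probability of `ℐ^u` in half-planes, the probability that the
component of `x` in `𝒱^u ∩ 𝒫` is finite and meets `∂_int B(x,L)` decays stretched
exponentially, uniformly over half-planes `𝒫` and `x ∈ 𝒫`. -/
theorem stmt4 (S : GraphSetup) (W : WalkLaw S) (cg cg' : ℝ) (hG : W.GreenBounds cg cg')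
    (RI : Interlacement S W) :
    ∀ u : ℝ, 0 ≤ u → u < RI.uTilde → ∀ κ' : ℝ, 0 < κ' → κ' < 1 →
      (∃ c₆ c₇ : ℝ, 0 < c₆ ∧ 0 < c₇ ∧ ∀ L : ℕ, 1 ≤ L →
          RI.starSup u L ≤ ENNReal.ofReal (c₆ * Real.exp (-c₇ * (L : ℝ) ^ κ'))) →
      ∃ c₈ c₉ : ℝ, 0 < c₈ ∧ 0 < c₉ ∧ ∀ L : ℕ, 1 ≤ L →
        (⨆ P : S.HalfPlane, ⨆ x : P.carrier,
            RI.prob {ω | (S.component (RI.vacant u ω ∩ P.carrier) x.1).Finite ∧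
              (S.component (RI.vacant u ω ∩ P.carrier) x.1 ∩
                S.intBoundary (S.ball x.1 L)).Nonempty}) ≤
          ENNReal.ofReal (c₈ * Real.exp (-c₉ * (L : ℝ) ^ κ')) := by
  intro u _ _ κ hκ _ ⟨c₆, c₇, hc₆, hc₇, hstar⟩
  obtain ⟨B, c, hB, hc, hsum⟩ := exists_tsum_stretched_exp_le hc₆ hc₇ hκ
  have := RI.isProb
  refine ⟨B + Real.exp (c * 16 ^ κ), c, by positivity, hc, fun L hL => ?_⟩
  refine iSup₂_le fun P x => ?_
  rcases lt_or_ge L 16 with h16 | h16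
  · refine (prob_le_one (μ := RI.prob)).trans ?_
    rw [← ENNReal.ofReal_one]
    refine ENNReal.ofReal_le_ofReal ?_
    have h1 : (L : ℝ) ^ κ ≤ 16 ^ κ :=
      Real.rpow_le_rpow L.cast_nonneg (by exact_mod_cast h16.le) hκ.le
    have h2 : 1 ≤ Real.exp (c * 16 ^ κ) * Real.exp (-c * (L : ℝ) ^ κ) := by
      rw [← Real.exp_add]
      exact Real.one_le_exp (by linarith [mul_le_mul_of_nonneg_left h1 hc.le])
    have h3 : 0 ≤ B * Real.exp (-c * (L : ℝ) ^ κ) := by positivity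
    linarith [add_mul B (Real.exp (c * 16 ^ κ)) (Real.exp (-c * (L : ℝ) ^ κ))]
  · calc _ ≤ ∑' k : ℕ, RI.starSup u ((L + (k + 1)) / 16) :=
          RI.prob_finite_component_le u P x L
      _ ≤ _ := ENNReal.tsum_le_tsum fun k => hstar _ (by omega)
      _ ≤ _ := hsum L h16
      _ ≤ _ := by
          refine ENNReal.ofReal_le_ofReal ?_
          gcongr
          exact le_add_of_nonneg_right (Real.exp_pos _).le
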